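/- arXiv:1607.01957 — 11 statements merged into one kernel-verified Lean document; each statement's English description precedes it below -/
import Mathlib

section
/- Let F be a field with characteristic different from 2 and from 3, and suppose F is not the five-element field (i.e., F does not have exactly 5 elements). Then every element a of F admits a balanced factorisation into a product of four factors: there exist x₁, x₂, x₃, x₄ in F such that a = x₁·x₂·x₃·x₄ and x₁ + x₂ + x₃ + x₄ = 0. -/
/-- Euler's rational parametrisation of `x * y * z * (x + y + z) = -a`. -/
lemma exists_balanced_factorisation_of_ne_zero {F : Type*} [Field F] (h2 : (2 : F) ≠ 0)
    (h3 : (3 : F) ≠ 0) {a t : F} (ht : t ≠ 0) (h₁ : 1 - 4 * a * t ^ 4 ≠ 0)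
    (h₂ : a * t ^ 4 + 2 ≠ 0) (hQ : 2 * a ^ 2 * t ^ 8 - 10 * a * t ^ 4 - 1 ≠ 0) :
    ∃ x₁ x₂ x₃ x₄ : F, a = x₁ * x₂ * x₃ * x₄ ∧ x₁ + x₂ + x₃ + x₄ = 0 := by
  have h6 : (6 : F) ≠ 0 := by
    rw [show (6 : F) = 2 * 3 by norm_num]
    exact mul_ne_zero h2 h3
  set u := 1 - 4 * a * t ^ 4 with hu
  set v := a * t ^ 4 + 2 with hv
  set Q := 2 * a ^ 2 * t ^ 8 - 10 * a * t ^ 4 - 1 with hq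
  refine ⟨-(6 * a * t ^ 3 * v ^ 2) / (u * Q), -(3 * u ^ 2) / (2 * t * v * Q),
    2 * Q / (3 * t * u), Q / (6 * t * v), ?_, ?_⟩
  · field_simp
  · field_simp
    rw [hu, hv, hq]
    ring

lemma exists_balanced_factorisation_of_lt_card {F : Type*} [Field F] (h2 : (2 : F) ≠ 0)
    (h3 : (3 : F) ≠ 0) (hF : (17 : Cardinal) < Cardinal.mk F) (a : F) :
    ∃ x₁ x₂ x₃ x₄ : F, a = x₁ * x₂ * x₃ * x₄ ∧ x₁ + x₂ + x₃ + x₄ = 0 := by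
  open Polynomial in
  let p : F[X] := X * (1 - 4 * C a * X ^ 4) * (C a * X ^ 4 + 2) *
    (2 * C a ^ 2 * X ^ 8 - 10 * C a * X ^ 4 - 1)
  have hp : p ≠ 0 := by
    have hne {q : Polynomial F} (h : q.eval 0 ≠ 0) : q ≠ 0 := by
      rintro rfl
      simp at h
    refine mul_ne_zero (mul_ne_zero (mul_ne_zero Polynomial.X_ne_zero ?_) ?_) ?_ <;>
      apply hne <;> simp [h2]
  have hdeg : p.natDegree ≤ 17 := by
    simp only [p]
    compute_degree
  obtain ⟨t, ht⟩ := p.exists_eval_ne_zero_of_natDegree_lt_card hp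
    (lt_of_le_of_lt (by exact_mod_cast hdeg) hF)
  simp only [p, Polynomial.eval_mul, Polynomial.eval_sub, Polynomial.eval_add,
    Polynomial.eval_pow, Polynomial.eval_X, Polynomial.eval_C, Polynomial.eval_one,
    Polynomial.eval_ofNat, mul_ne_zero_iff] at ht
  obtain ⟨⟨⟨ht, h₁⟩, h₂⟩, hQ⟩ := ht
  exact exists_balanced_factorisation_of_ne_zero h2 h3 ht h₁ h₂ hQ

lemma exists_balanced_factorisation_of_ringEquiv {R S : Type*} [CommRing R] [CommRing S]
    (e : R ≃+* S)
    (h : ∀ a : R, ∃ x₁ x₂ x₃ : R, a = x₁ * x₂ * x₃ * -(x₁ + x₂ + x₃)) (a : S) :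
    ∃ x₁ x₂ x₃ x₄ : S, a = x₁ * x₂ * x₃ * x₄ ∧ x₁ + x₂ + x₃ + x₄ = 0 := by
  obtain ⟨x₁, x₂, x₃, hx⟩ := h (e.symm a)
  refine ⟨e x₁, e x₂, e x₃, -(e x₁ + e x₂ + e x₃), ?_, by ring⟩
  simpa using congrArg e hx

/-- In any field of characteristic not two and not three, other than the
five-element field, each element admits a balanced decomposition into a
product of four factors. -/
theorem balanced_factorisation_four_factors
    {F : Type*} [Field F] (h2 : ringChar F ≠ 2) (h3 : ringChar F ≠ 3)
    (h5 : Nat.card F ≠ 5) (a : F) :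
    ∃ x₁ x₂ x₃ x₄ : F, a = x₁ * x₂ * x₃ * x₄ ∧ x₁ + x₂ + x₃ + x₄ = 0 := by
  have hne (p : ℕ) (hp : p.Prime) (h : ringChar F ≠ p) : (p : F) ≠ 0 := fun h0 =>
    ((Nat.dvd_prime hp).1 ((ringChar.spec F p).1 h0)).elim CharP.ringChar_ne_one h
  by_cases hF : (17 : Cardinal) < Cardinal.mk F
  · exact exists_balanced_factorisation_of_lt_card (by exact_mod_cast hne 2 Nat.prime_two h2)
      (by exact_mod_cast hne 3 Nat.prime_three h3) hF a
  have : Finite F := Cardinal.lt_aleph0_iff_finite.1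
    (lt_of_le_of_lt (not_lt.1 hF) (Cardinal.ofNat_lt_aleph0))
  have := Fintype.ofFinite F
  have hle : Fintype.card F ≤ 17 := by
    rw [not_lt, Cardinal.mk_fintype] at hF
    exact_mod_cast hF
  rw [Nat.card_eq_fintype_card] at h5
  obtain ⟨n, hp, hcard⟩ := FiniteField.card F (ringChar F)
  have h4 : 4 < ringChar F := by
    have := hp.two_le
    have : ringChar F ≠ 4 := fun h => by
      rw [h] at hp
      norm_num at hp
    omega
  have hn : (n : ℕ) = 1 := by
    by_contra hn
    have := n.pos
    have := Nat.pow_le_pow_right hp.pos (show 2 ≤ (n : ℕ) by omega)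
    nlinarith
  rw [hn, pow_one] at hcard
  rw [← hcard] at hp h4
  clear hcard
  generalize hc : Fintype.card F = p at *
  interval_cases p <;> first | omega | (norm_num at hp; done) |
    exact exists_balanced_factorisation_of_ringEquiv (ZMod.ringEquivOfPrime F hp hc)
      (by decide +kernel) a
end

section
/- Let F be an infinite field with characteristic different from 2 and from 3. Then every element a of F admits infinitely many balanced factorisations into a product of four factors: the set of 4-tuples (x₁, x₂, x₃, x₄) in F⁴ with a = x₁·x₂·x₃·x₄ and x₁ + x₂ + x₃ + x₄ = 0 is infinite. -/
/-- Euler's one-parameter family of solutions of `x * y * z * (x + y + z) = b`, written with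
`w = -(x + y + z)`. -/
theorem euler_balanced_factorisation {F : Type*} [Field F] (h2 : (2 : F) ≠ 0) (h3 : (3 : F) ≠ 0)
    {b s : F} (hs : s ≠ 0) (h₁ : b - 2 * s ^ 4 ≠ 0) (h₂ : 4 * b + s ^ 4 ≠ 0)
    (hQ : 2 * b ^ 2 + 10 * b * s ^ 4 - s ^ 8 ≠ 0) :
    ∃ x y z w : F, x * y * z * w = -b ∧ x + y + z + w = 0 ∧
      w * (6 * s ^ 3 * (b - 2 * s ^ 4)) + (2 * b ^ 2 + 10 * b * s ^ 4 - s ^ 8) = 0 := by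
  have h6 : (6 : F) = 2 * 3 := by norm_num
  obtain ⟨U, hU⟩ : ∃ U, U = b - 2 * s ^ 4 := ⟨_, rfl⟩
  obtain ⟨V, hV⟩ : ∃ V, V = 4 * b + s ^ 4 := ⟨_, rfl⟩
  obtain ⟨Q, hQ'⟩ : ∃ Q, Q = 2 * b ^ 2 + 10 * b * s ^ 4 - s ^ 8 := ⟨_, rfl⟩
  rw [← hU] at h₁ ⊢
  rw [← hV] at h₂
  rw [← hQ'] at hQ ⊢
  refine ⟨2 * 3 * b * s * U ^ 2 / (V * Q), 3 * s ^ 5 * V ^ 2 / (2 * U * Q),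
    2 * Q / (3 * s ^ 3 * V), -Q / (2 * 3 * s ^ 3 * U), ?_, ?_, ?_⟩
  · field_simp
  · field_simp
    subst hU hV hQ'
    ring
  · rw [h6]
    field_simp
    ring

open Polynomial in
/-- In an infinite field of characteristic not two and not three, each element
admits infinitely many balanced decompositions into a product of four factors. -/
theorem infinitely_many_balanced_factorisations_four_factors
    {F : Type*} [Field F] [Infinite F]
    (h2 : ringChar F ≠ 2) (h3 : ringChar F ≠ 3) (a : F) :
    {t : F × F × F × F |
      a = t.1 * t.2.1 * t.2.2.1 * t.2.2.2 ∧
      t.1 + t.2.1 + t.2.2.1 + t.2.2.2 = 0}.Infinite := by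
  have two_ne : (2 : F) ≠ 0 := Ring.two_ne_zero h2
  have three_ne : (3 : F) ≠ 0 := fun h ↦ by
    have hd : ringChar F ∣ 3 := ringChar.dvd (by exact_mod_cast h)
    rcases (Nat.dvd_prime Nat.prime_three).1 hd with h1 | h1
    · exact CharP.ringChar_ne_one h1
    · exact h3 h1
  rcases eq_or_ne a 0 with rfl | ha
  · refine (Set.infinite_range_of_injective
      (f := fun t : F ↦ ((0, 0, t, -t) : F × F × F × F)) ?_).mono ?_
    · intro s t h
      simpa using h
    · rintro _ ⟨t, rfl⟩
      simp
  obtain ⟨b, rfl⟩ : ∃ b, a = -b := ⟨-a, by simp⟩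
  have hb : b ≠ 0 := by simpa using ha
  intro hfin
  let Q : F[X] := 2 * C b ^ 2 + 10 * C b * X ^ 4 - X ^ 8
  let P : F → F[X] := fun w ↦ C w * (6 * X ^ 3 * (C b - 2 * X ^ 4)) + Q
  let B : F[X] := X * (C b - 2 * X ^ 4) * (4 * C b + X ^ 4) * Q
  have ne_of_eval {p : F[X]} (h : p.eval 0 ≠ 0) : p ≠ 0 := by
    rintro rfl
    simp at h
  have hQ : Q ≠ 0 := ne_of_eval (by simp [Q, two_ne, hb])
  have hP (w : F) : P w ≠ 0 := ne_of_eval (by simp [P, Q, two_ne, hb])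
  have four_ne : (4 : F) ≠ 0 := by
    rw [show (4 : F) = 2 * 2 by norm_num]
    exact mul_ne_zero two_ne two_ne
  have hB : B ≠ 0 :=
    mul_ne_zero (mul_ne_zero (mul_ne_zero X_ne_zero (ne_of_eval (by simp [hb])))
      (ne_of_eval (by simp [four_ne, hb]))) hQ
  refine Set.infinite_univ (α := F) (((finite_setOfPred_isRoot hB).union
    ((hfin.image fun t ↦ t.2.2.2).biUnion fun w _ ↦ finite_setOfPred_isRoot (hP w))).subset ?_)
  intro s _
  by_cases hs : B.IsRoot s
  · exact Or.inl hs
  simp only [B, Q, IsRoot.def, eval_mul, eval_sub, eval_add, eval_pow, eval_X, eval_C,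
    eval_ofNat, mul_eq_zero, not_or] at hs
  obtain ⟨x, y, z, w, hmul, hadd, hw⟩ :=
    euler_balanced_factorisation two_ne three_ne hs.1.1.1 hs.1.1.2 hs.1.2 hs.2
  refine Or.inr (Set.mem_biUnion (x := w) ⟨(x, y, z, w), ⟨hmul.symm, hadd⟩, rfl⟩ ?_)
  simpa [P, Q] using hw
end

section
/- Let F be a field with characteristic different from 2 and from 3, and let x ∈ F satisfy (1−4x)(1+8x) ≠ 0. Then x = (2(1−4x)²/(3(1+8x))) · (−(1+8x)/6) · (−(1+8x)/(2(1−4x))) · (18x/((1−4x)(1+8x))), and the sum of these four factors equals 0. -/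
theorem three_ne_zero_of_ringChar_ne_three {R : Type*} [NonAssocRing R] [Nontrivial R]
    (h : ringChar R ≠ 3) : (3 : R) ≠ 0 := by
  intro h0
  have hdvd : ringChar R ∣ 3 := ringChar.dvd (by exact_mod_cast h0)
  rcases (Nat.dvd_prime Nat.prime_three).mp hdvd with h1 | h1
  · exact CharP.ringChar_ne_one h1
  · exact h h1

/-- The key identity: for `x` with `(1-4x)(1+8x) ≠ 0` in a field of
characteristic not two and not three, `x` is the product of the four displayed
factors, and the sum of these factors is zero. -/
theorem balanced_factorisation_identity
    {F : Type*} [Field F] (h2 : ringChar F ≠ 2) (h3 : ringChar F ≠ 3)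
    (x : F) (hx : (1 - 4 * x) * (1 + 8 * x) ≠ 0) :
    x = (2 * (1 - 4 * x) ^ 2 / (3 * (1 + 8 * x))) *
          (-(1 + 8 * x) / 6) *
          (-(1 + 8 * x) / (2 * (1 - 4 * x))) *
          (18 * x / ((1 - 4 * x) * (1 + 8 * x))) ∧
    (2 * (1 - 4 * x) ^ 2 / (3 * (1 + 8 * x))) +
          (-(1 + 8 * x) / 6) +
          (-(1 + 8 * x) / (2 * (1 - 4 * x))) +
          (18 * x / ((1 - 4 * x) * (1 + 8 * x))) = 0 := by
  obtain ⟨ha, hb⟩ := mul_ne_zero_iff.mp hx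
  have two_ne : (2 : F) ≠ 0 := Ring.two_ne_zero h2
  have three_ne : (3 : F) ≠ 0 := three_ne_zero_of_ringChar_ne_three h3
  have six_eq : (6 : F) = 2 * 3 := by norm_num
  rw [six_eq]
  constructor
  · generalize 1 - 4 * x = a at ha
    generalize 1 + 8 * x = b at hb
    field_simp
    ring
  · field_simp
    ring
end

section
/- Let F be an infinite field of characteristic different from 2 and let k ≥ 5 be an integer. Then every element a of F admits infinitely many balanced factorisations into a product of k factors: the set of k-tuples (x₁, …, x_k) in F^k with x₁·⋯·x_k = a and x₁ + ⋯ + x_k = 0 is infinite. -/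
/-- Prepending `1, -1` turns balanced factorisations of `-a` into `k` factors into balanced
factorisations of `a` into `k + 2` factors. -/
lemma infinite_balanced_factorisations_add_two {R : Type*} [CommRing R] {k : ℕ} {a : R}
    (h : {x : Fin k → R | (∏ i, x i) = -a ∧ (∑ i, x i) = 0}.Infinite) :
    {x : Fin (k + 2) → R | (∏ i, x i) = a ∧ (∑ i, x i) = 0}.Infinite := by
  refine Set.infinite_of_injOn_mapsTo
    (f := fun x => (Fin.cons 1 (Fin.cons (-1) x : Fin (k + 1) → R) : Fin (k + 2) → R)) ?_ ?_ h
  · intro x _ y _ h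
    exact Fin.cons_right_injective _ (Fin.cons_right_injective _ h)
  · rintro x ⟨hp, hs⟩
    simp [Fin.prod_univ_succ, Fin.sum_univ_succ, hp, hs]

lemma infinite_balanced_factorisations_five {F : Type*} [Field F] [Infinite F] (a : F) :
    {x : Fin 5 → F | (∏ i, x i) = a ∧ (∑ i, x i) = 0}.Infinite := by
  rcases eq_or_ne a 0 with rfl | ha
  · refine Set.infinite_of_injective_forall_mem (f := fun t : F => ![t, -t, 0, 0, 0]) ?_ ?_
    · intro s t h
      simpa using congrFun h 0
    · intro t
      simp [Fin.prod_univ_succ, Fin.sum_univ_succ]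
  · have hs : ({0, -1}ᶜ : Set F).Infinite := (Set.toFinite _).infinite_compl
    refine Set.infinite_of_injOn_mapsTo (f := fun u : F =>
      ![a / (u * (1 + u)), a / (1 + u), -(a / u), u * (1 + u) / a, -(u * (1 + u) / a)])
      ?_ ?_ hs
    · intro u hu v hv h
      simp only [Set.mem_compl_iff, Set.mem_insert_iff, Set.mem_singleton_iff, not_or] at hu hv
      have h2 : -(a / u) = -(a / v) := congrFun h 2
      have hu0 := hu.1
      have hv0 := hv.1
      field_simp at h2
      exact (neg_injective h2).symm
    · intro u hu
      simp only [Set.mem_compl_iff, Set.mem_insert_iff, Set.mem_singleton_iff, not_or] at hu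
      have hu0 := hu.1
      have hu1 : 1 + u ≠ 0 := fun h => hu.2 (by linear_combination h)
      constructor
      · simp [Fin.prod_univ_succ]
        field_simp
      · simp [Fin.sum_univ_succ]
        field_simp
        ring

lemma infinite_balanced_factorisations_six {F : Type*} [Field F] [Infinite F]
    (h2 : (2 : F) ≠ 0) (a : F) :
    {x : Fin 6 → F | (∏ i, x i) = a ∧ (∑ i, x i) = 0}.Infinite := by
  rcases eq_or_ne a 0 with rfl | ha
  · refine Set.infinite_of_injective_forall_mem (f := fun t : F => ![t, -t, 0, 0, 0, 0]) ?_ ?_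
    · intro s t h
      simpa using congrFun h 0
    · intro t
      simp [Fin.prod_univ_succ, Fin.sum_univ_succ]
  · obtain ⟨p, hp0, hp⟩ : ∃ p : F, p ≠ 0 ∧ 1 - a * p ^ 2 ≠ 0 := by
      rcases eq_or_ne a 1 with rfl | ha1
      · obtain ⟨p, hp⟩ := (Set.toFinite ({0, 1, -1} : Set F)).exists_notMem
        simp only [Set.mem_insert_iff, Set.mem_singleton_iff, not_or] at hp
        refine ⟨p, hp.1, fun h => ?_⟩
        rcases sq_eq_one_iff.mp (by linear_combination -h : p ^ 2 = 1) with h | h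
        · exact hp.2.1 h
        · exact hp.2.2 h
      · exact ⟨1, one_ne_zero, by simpa [sub_eq_zero] using ha1.symm⟩
    obtain ⟨r, hr⟩ : ∃ r : F, 2 * r = 1 - a * p ^ 2 := ⟨_, mul_div_cancel₀ _ h2⟩
    have hr0 : r ≠ 0 := by
      rintro rfl
      exact hp (by simpa using hr.symm)
    have hs : ({0}ᶜ : Set F).Infinite := (Set.toFinite _).infinite_compl
    refine Set.infinite_of_injOn_mapsTo (f := fun l : F =>
      ![l, -(l * (a * p ^ 2)), -(l * r), -(l * r), (p * r * l ^ 2)⁻¹, -(p * r * l ^ 2)⁻¹])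
      ?_ ?_ hs
    · intro u _ v _ h
      exact congrFun h 0
    · intro l hl
      have hl0 : l ≠ 0 := hl
      constructor
      · simp [Fin.prod_univ_succ]
        field_simp
      · simp [Fin.sum_univ_succ]
        linear_combination -l * hr

/-- In an infinite field of characteristic not two, each element admits
infinitely many balanced decompositions into a product of `k` factors, for
every `k ≥ 5`. -/
theorem infinitely_many_balanced_factorisations_of_ge_five_factors
    {F : Type*} [Field F] [Infinite F] (h2 : ringChar F ≠ 2)
    (k : ℕ) (hk : 5 ≤ k) (a : F) :
    {x : Fin k → F | (∏ i, x i) = a ∧ (∑ i, x i) = 0}.Infinite := by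
  induction k using Nat.strong_induction_on generalizing a with
  | _ k ih =>
    obtain rfl | rfl | h7 : k = 5 ∨ k = 6 ∨ 7 ≤ k := by omega
    · exact infinite_balanced_factorisations_five a
    · exact infinite_balanced_factorisations_six (Ring.two_ne_zero h2) a
    · obtain ⟨m, rfl⟩ : ∃ m, k = m + 2 := ⟨k - 2, by omega⟩
      exact infinite_balanced_factorisations_add_two (ih m (by omega) (by omega) (-a))
end

section
/- Let n ≥ 2 and k ≥ 3 be integers and let F be a field. If every n × n matrix over F has a balanced decomposition into a product of k pairwise commuting factors, then every element of F has a non-power balanced factorisation into a product of k factors. -/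
namespace Matrix

variable {F : Type*} [Field F] {m : ℕ}

/-- The nilpotent Jordan block, with ones on the superdiagonal. -/
def superdiagonalShift (F : Type*) [Field F] (m : ℕ) : Matrix (Fin (m + 1)) (Fin (m + 1)) F :=
  of fun i j => if (i : ℕ) + 1 = j then 1 else 0

lemma superdiagonalShift_mul_castSucc (X : Matrix (Fin (m + 1)) (Fin (m + 1)) F)
    (i : Fin m) (j : Fin (m + 1)) :
    (superdiagonalShift F m * X) i.castSucc j = X i.succ j := by
  rw [mul_apply, Finset.sum_eq_single i.succ]
  · simp [superdiagonalShift]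
  · intro b _ hb
    have : ¬ (i : ℕ) + 1 = b := fun h => hb (Fin.ext (by simp [h]))
    simp [superdiagonalShift, this]
  · simp

lemma mul_superdiagonalShift_zero (X : Matrix (Fin (m + 1)) (Fin (m + 1)) F)
    (i : Fin (m + 1)) : (X * superdiagonalShift F m) i 0 = 0 := by
  simp [mul_apply, superdiagonalShift]

lemma mul_superdiagonalShift_succ (X : Matrix (Fin (m + 1)) (Fin (m + 1)) F)
    (i : Fin (m + 1)) (j : Fin m) :
    (X * superdiagonalShift F m) i j.succ = X i j.castSucc := by
  rw [mul_apply, Finset.sum_eq_single j.castSucc]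
  · simp [superdiagonalShift]
  · intro b _ hb
    have : ¬ (b : ℕ) = j := fun h => hb (Fin.ext (by simp [h]))
    simp [superdiagonalShift, this]
  · simp

lemma apply_succ_zero_of_commute {X : Matrix (Fin (m + 1)) (Fin (m + 1)) F}
    (h : Commute X (superdiagonalShift F m)) (i : Fin m) : X i.succ 0 = 0 := by
  rw [← superdiagonalShift_mul_castSucc X, ← h.eq, mul_superdiagonalShift_zero]

lemma apply_succ_succ_of_commute {X : Matrix (Fin (m + 1)) (Fin (m + 1)) F}
    (h : Commute X (superdiagonalShift F m)) (i j : Fin m) :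
    X i.succ j.succ = X i.castSucc j.castSucc := by
  rw [← superdiagonalShift_mul_castSucc X, ← h.eq, mul_superdiagonalShift_succ]

lemma mul_apply_zero_zero_of_commute (X : Matrix (Fin (m + 1)) (Fin (m + 1)) F)
    {Y : Matrix (Fin (m + 1)) (Fin (m + 1)) F}
    (hY : Commute Y (superdiagonalShift F m)) : (X * Y) 0 0 = X 0 0 * Y 0 0 := by
  simp [mul_apply, Fin.sum_univ_succ, apply_succ_zero_of_commute hY]

lemma mul_apply_zero_one_of_commute (X : Matrix (Fin (m + 2)) (Fin (m + 2)) F)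
    {Y : Matrix (Fin (m + 2)) (Fin (m + 2)) F}
    (hY : Commute Y (superdiagonalShift F (m + 1))) :
    (X * Y) 0 1 = X 0 0 * Y 0 1 + X 0 1 * Y 0 0 := by
  have h1 (i : Fin (m + 1)) : Y i.succ 1 = Y i.castSucc 0 := by
    simpa using apply_succ_succ_of_commute hY i 0
  simp [mul_apply, Fin.sum_univ_succ, h1, apply_succ_zero_of_commute hY]

lemma list_prod_apply_zero_zero_of_commute (l : List (Matrix (Fin (m + 1)) (Fin (m + 1)) F))
    (hl : ∀ X ∈ l, Commute X (superdiagonalShift F m)) :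
    l.prod 0 0 = (l.map fun X => X 0 0).prod := by
  induction l with
  | nil => simp
  | cons X l ih =>
    rw [List.forall_mem_cons] at hl
    rw [List.prod_cons, mul_apply_zero_zero_of_commute X (Commute.list_prod_left l _ hl.2), ih hl.2,
      List.map_cons, List.prod_cons]

lemma list_prod_apply_zero_one_of_commute (l : List (Matrix (Fin (m + 2)) (Fin (m + 2)) F)) (x : F)
    (hl : ∀ X ∈ l, Commute X (superdiagonalShift F (m + 1))) (hx : ∀ X ∈ l, X 0 0 = x) :
    l.prod 0 1 = x ^ (l.length - 1) * (l.map fun X => X 0 1).sum := by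
  induction l with
  | nil => simp
  | cons X l ih =>
    rw [List.forall_mem_cons] at hl hx
    rw [List.prod_cons, mul_apply_zero_one_of_commute X (Commute.list_prod_left l _ hl.2),
      ih hl.2 hx.2, list_prod_apply_zero_zero_of_commute l hl.2, hx.1,
      List.map_congr_left (g := fun _ => x) hx.2]
    cases l with
    | nil => simp
    | cons Y l => simp; ring

end Matrix


/-- For integers `n ≥ 2` and `k ≥ 3` and a field `F`: if every `n × n` matrix
over `F` has a balanced decomposition into a product of `k` pairwise
commuting factors, then every element of `F` has a non-power balanced
factorisation into a product of `k` factors. -/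
theorem nonpower_field_factorisation_of_balanced_matrix_decomposition
    {F : Type*} [Field F] (n k : ℕ) (hn : 2 ≤ n) (hk : 3 ≤ k)
    (h : ∀ A : Matrix (Fin n) (Fin n) F,
      ∃ X : Fin k → Matrix (Fin n) (Fin n) F,
        (∀ i j, X i * X j = X j * X i) ∧
        A = (List.ofFn X).prod ∧ (∑ i, X i) = 0) :
    ∀ a : F, ∃ x : Fin k → F,
        (∏ i, x i) = a ∧ (∑ i, x i) = 0 ∧ ¬ ∀ i j, x i = x j := by
  intro a
  obtain ⟨m, rfl⟩ := Nat.exists_eq_add_of_le' hn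
  set N := Matrix.superdiagonalShift F (m + 1) with hN
  obtain ⟨X, hX, hA, hsum⟩ := h (Matrix.scalar _ a + N)
  have hcomm : ∀ Y ∈ List.ofFn X, Commute Y N := by
    rw [List.forall_mem_ofFn_iff]
    intro i
    have h1 : Commute (X i) (Matrix.scalar _ a + N) := by
      rw [hA]
      exact Commute.list_prod_right _ _ (List.forall_mem_ofFn_iff.2 fun j => hX i j)
    simpa using h1.sub_right (Matrix.scalar_commute a (Commute.all a) (X i)).symm
  have hentry (i j : Fin (m + 2)) : ∑ t, X t i j = 0 := by
    rw [← Matrix.sum_apply, hsum, Matrix.zero_apply]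
  refine ⟨fun i => X i 0 0, ?_, hentry 0 0, fun heq => ?_⟩
  · have h00 := Matrix.list_prod_apply_zero_zero_of_commute _ hcomm
    rw [← hA, List.map_ofFn, List.prod_ofFn] at h00
    simpa [hN, Matrix.superdiagonalShift] using h00.symm
  · have h01 := Matrix.list_prod_apply_zero_one_of_commute _ (X ⟨0, by omega⟩ 0 0) hcomm
      (List.forall_mem_ofFn_iff.2 fun i => heq i _)
    rw [← hA, List.map_ofFn, List.sum_ofFn] at h01
    simp [hN, Matrix.superdiagonalShift, hentry] at h01
end

section
/- Let F be a finite field of characteristic 3 with at least 9 elements. Then every element a of F has a non-power balanced factorisation into a product of three factors: there exist x, y, z in F, not all equal, with a = x·y·z and x + y + z = 0. -/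
/-- In a finite field of characteristic three with at least nine elements,
every element has a non-power balanced factorisation into a product of three
factors. -/
theorem nonpower_balanced_three_factors_char_three
    {F : Type*} [Field F] [Fintype F] [CharP F 3]
    (hcard : 9 ≤ Fintype.card F) (a : F) :
    ∃ x y z : F, ¬ (x = y ∧ y = z) ∧ a = x * y * z ∧ x + y + z = 0 := by
  classical
  have h3 : (3 : F) = 0 := by exact_mod_cast CharP.cast_eq_zero F 3
  have : Fact (Nat.Prime 3) := ⟨Nat.prime_three⟩
  obtain ⟨b, rfl⟩ : ∃ b : F, b ^ 3 = a := surjective_frobenius F 3 a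
  by_cases hb : b = 0
  · exact ⟨0, 1, -1, by simp, by simp [hb], by ring⟩
  obtain ⟨t, ht⟩ : ∃ t : F, t ∉ ({0, 1, -1} : Finset F) := by
    by_contra! h
    have hle := (Finset.card_le_card fun x _ ↦ h x :
      (Finset.univ : Finset F).card ≤ ({0, 1, -1} : Finset F).card)
    have := hle.trans Finset.card_le_three
    rw [Finset.card_univ] at this
    omega
  simp only [Finset.mem_insert, Finset.mem_singleton, not_or] at ht
  obtain ⟨h0, h1, h2⟩ := ht
  have h1' : t - 1 ≠ 0 := sub_ne_zero.mpr h1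
  have h2' : t + 1 ≠ 0 := fun h ↦ h2 (eq_neg_of_add_eq_zero_left h)
  obtain ⟨v, hv⟩ : ∃ v : F, v * (t * (t + 1)) = -(t - 1) ^ 2 :=
    ⟨-(t - 1) ^ 2 / (t * (t + 1)), div_mul_cancel₀ _ (mul_ne_zero h0 h2')⟩
  have hv0 : v ≠ 0 := by
    rintro rfl
    simp [h1'] at hv
  refine ⟨b * (1 + t * v), b * (1 + v), b * (1 - (t + 1) * v), fun ⟨h, _⟩ ↦ ?_, ?_, ?_⟩
  · have : b * ((t - 1) * v) = 0 := by linear_combination h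
    exact mul_ne_zero hb (mul_ne_zero h1' hv0) this
  · linear_combination b ^ 3 * v ^ 2 * hv + b ^ 3 * t * v ^ 2 * h3
  · linear_combination b * h3
end

section
/- Let F be a field of characteristic different from 2 with at least 5 elements and let k = 6 + 2m for an integer m ≥ 0. Then every element a of F has a non-power balanced factorisation into a product of k factors: there exist x₁, …, x_k in F, not all equal, with x₁·⋯·x_k = a and x₁ + ⋯ + x_k = 0. -/
/-- A field with at least five elements contains an element other than `0`, `1` and `-1`. -/
theorem exists_ne_zero_sq_ne_one {F : Type*} [Field F] (hcard : 5 ≤ Cardinal.mk F) :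
    ∃ s : F, s ≠ 0 ∧ s ^ 2 ≠ 1 := by
  classical
  by_contra! h
  have huniv : ((({0, 1, -1} : Finset F) : Set F)) = Set.univ := by
    ext s
    by_cases hs : s = 0
    · simp [hs]
    · simpa [hs] using sq_eq_one_iff.mp (h s hs)
  have hle : Cardinal.mk F ≤ 3 := by
    rw [← Cardinal.mk_univ, ← huniv, Finset.coe_sort_coe, Cardinal.mk_coe_finset]
    exact_mod_cast Finset.card_le_three
  exact absurd (hcard.trans hle) (by norm_num)

/-- Every element of a field of characteristic not two with at least five elements has a non-power
balanced factorisation into six factors. -/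
theorem nonpower_balanced_six_factors {F : Type*} [Field F] (h2 : ringChar F ≠ 2)
    (hcard : 5 ≤ Cardinal.mk F) (a : F) :
    ∃ x : Fin 6 → F, (¬ ∀ i j, x i = x j) ∧ (∏ i, x i) = a ∧ (∑ i, x i) = 0 := by
  have two_ne : (2 : F) ≠ 0 := Ring.two_ne_zero h2
  rcases eq_or_ne a 0 with rfl | ha
  · refine ⟨![0, 0, 0, 0, 1, -1], fun h => ?_, ?_, ?_⟩
    · simpa using h 0 4
    · simp [Fin.prod_univ_succ]
    · simp [Fin.sum_univ_succ]
  obtain ⟨s, hs, has⟩ : ∃ s : F, s ≠ 0 ∧ a * s ^ 2 - 1 ≠ 0 := by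
    rcases eq_or_ne a 1 with rfl | ha1
    · obtain ⟨s, hs, hs1⟩ := exists_ne_zero_sq_ne_one hcard
      exact ⟨s, hs, by simpa [sub_eq_zero] using hs1⟩
    · exact ⟨1, one_ne_zero, by simpa [sub_eq_zero] using ha1⟩
  set d := a * s ^ 2 - 1 with hd
  refine ⟨![-(a * s ^ 2), 1, d / 2, d / 2, 2 / (s * d), -(2 / (s * d))], fun h => ?_, ?_, ?_⟩
  · have h45 : 2 / (s * d) = -(2 / (s * d)) := h 4 5
    have hzero : 2 * (2 / (s * d)) = 0 := by linear_combination h45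
    exact mul_ne_zero two_ne (div_ne_zero two_ne (mul_ne_zero hs has)) hzero
  · rw [Fin.prod_univ_six]
    change -(a * s ^ 2) * 1 * (d / 2) * (d / 2) * (2 / (s * d)) * -(2 / (s * d)) = a
    field_simp
  · rw [Fin.sum_univ_six]
    change -(a * s ^ 2) + 1 + d / 2 + d / 2 + 2 / (s * d) + -(2 / (s * d)) = 0
    have halves : d / 2 + d / 2 = d := by field_simp; ring
    linear_combination halves + hd

/-- Appending the factors `1` and `-1` to a non-power balanced factorisation of `a` gives one
of `-a`. -/
theorem exists_nonpower_balanced_add_two {R : Type*} [CommRing R] {n : ℕ} {x : Fin n → R} {a : R}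
    (hx : ¬ ∀ i j, x i = x j) (hprod : ∏ i, x i = a) (hsum : ∑ i, x i = 0) :
    ∃ y : Fin (n + 2) → R, (¬ ∀ i j, y i = y j) ∧ (∏ i, y i) = -a ∧ (∑ i, y i) = 0 := by
  refine ⟨Fin.cons 1 (Fin.cons (-1) x : Fin (n + 1) → R), fun h => hx fun i j => ?_, ?_, ?_⟩
  · simpa using h i.succ.succ j.succ.succ
  · rw [Fin.prod_cons, Fin.prod_cons, hprod]
    ring
  · rw [Fin.sum_cons, Fin.sum_cons, hsum]
    ring

/-- In a field of characteristic not two with at least five elements, every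
element has a non-power balanced factorisation into a product of
`k = 6 + 2m` factors, `m ≥ 0`. -/
theorem nonpower_balanced_even_ge_six_factors
    {F : Type*} [Field F] (h2 : ringChar F ≠ 2)
    (hcard : 5 ≤ Cardinal.mk F)
    (m k : ℕ) (hk : k = 6 + 2 * m) (a : F) :
    ∃ x : Fin k → F,
      (¬ ∀ i j, x i = x j) ∧ (∏ i, x i) = a ∧ (∑ i, x i) = 0 := by
  subst hk
  induction m generalizing a with
  | zero => exact nonpower_balanced_six_factors h2 hcard a
  | succ m ih =>
    obtain ⟨x, hx, hprod, hsum⟩ := ih (-a)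
    exact neg_neg a ▸ exists_nonpower_balanced_add_two hx hprod hsum
end

section
/- Let F be a finite field of characteristic 2 with at least 4 elements and let k = 4 + 2m for an integer m ≥ 0. Then every element a of F has a non-power balanced factorisation into a product of k factors: there exist x₁, …, x_k in F, not all equal, with x₁·⋯·x_k = a and x₁ + ⋯ + x_k = 0. -/
/-- In a finite field of characteristic two with at least four elements,
every element has a non-power balanced factorisation into a product of
`k = 4 + 2m` factors, `m ≥ 0`. -/
theorem nonpower_balanced_even_ge_four_factors_char_two
    {F : Type*} [Field F] [Fintype F] [CharP F 2]
    (hcard : 4 ≤ Fintype.card F)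
    (m k : ℕ) (hk : k = 4 + 2 * m) (a : F) :
    ∃ x : Fin k → F,
      (¬ ∀ i j, x i = x j) ∧ (∏ i, x i) = a ∧ (∑ i, x i) = 0 := by
  subst hk
  obtain ⟨s, hs⟩ : ∃ s : F, s * s = a := by
    obtain ⟨s, hs⟩ := FiniteField.isSquare_of_char_two (ringChar.eq F 2) a
    exact ⟨s, hs.symm⟩
  obtain ⟨r, hr⟩ : ∃ r : F, r * r = s := by
    obtain ⟨r, hr⟩ := FiniteField.isSquare_of_char_two (ringChar.eq F 2) s
    exact ⟨r, hr.symm⟩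
  obtain ⟨u, hu⟩ : ∃ u : F, u ∉ ({0, r} : Set F) := by
    classical
    by_contra! h
    have hle := Finset.card_le_card (fun u _ => by simpa using h u :
      (Finset.univ : Finset F) ⊆ {0, r})
    have htwo := Finset.card_le_two (a := (0 : F)) (b := r)
    rw [Finset.card_univ] at hle
    omega
  simp only [Set.mem_insert_iff, Set.mem_singleton_iff, not_or] at hu
  obtain ⟨hu0, hur⟩ := hu
  refine ⟨Fin.append ![u, u, s / u, s / u] (fun _ : Fin (2 * m) => 1), ?_, ?_, ?_⟩
  · intro h
    have h02 := h (Fin.castAdd _ 0) (Fin.castAdd _ 2)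
    rw [Fin.append_left, Fin.append_left] at h02
    have hus : u = s / u := h02
    rw [eq_div_iff hu0, ← hr, ← pow_two, ← pow_two] at hus
    exact hur (frobenius_inj F 2 hus)
  · rw [Fin.prod_univ_add]
    simp only [Fin.append_left, Fin.append_right, Fin.prod_univ_four, Finset.prod_const_one]
    simp
    field_simp
    rw [← hs, pow_two]
  · rw [Fin.sum_univ_add]
    simp only [Fin.append_left, Fin.append_right, Fin.sum_univ_four]
    simp [CharTwo.add_self_eq_zero, CharTwo.two_eq_zero]
end

section
/- Over the two-element field F₂, a 2 × 2 matrix A admits a balanced decomposition into a product of three factors (i.e., there exist 2 × 2 matrices X₁, X₂, X₃ over F₂ with A = X₁·X₂·X₃ and X₁ + X₂ + X₃ = 0) if and only if A is neither the matrix with rows (1,1),(1,0) nor the matrix with rows (0,1),(1,1). -/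
/-- The entrywise form of the result: over `𝔽₂`, the product `X * Y * (X + Y)` of `2 × 2` matrices
with entries `a b c d` and `e f g h` takes every value except two. -/
theorem exists_entries_mul_mul_add_iff : ∀ p q r s : ZMod 2,
    (∃ a b c d e f g h : ZMod 2,
      p = (a * e + b * g) * (a + e) + (a * f + b * h) * (c + g) ∧
      q = (a * e + b * g) * (b + f) + (a * f + b * h) * (d + h) ∧
      r = (c * e + d * g) * (a + e) + (c * f + d * h) * (c + g) ∧
      s = (c * e + d * g) * (b + f) + (c * f + d * h) * (d + h)) ↔
      (¬(p = 1 ∧ q = 1 ∧ r = 1 ∧ s = 0) ∧ ¬(p = 0 ∧ q = 1 ∧ r = 1 ∧ s = 1)) := by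
  decide +kernel

/-- Over `𝔽₂`, a balanced decomposition into three factors is determined by its first two. -/
theorem exists_balanced_three_factors_iff (A : Matrix (Fin 2) (Fin 2) (ZMod 2)) :
    (∃ X₁ X₂ X₃ : Matrix (Fin 2) (Fin 2) (ZMod 2), A = X₁ * X₂ * X₃ ∧ X₁ + X₂ + X₃ = 0) ↔
      ∃ X Y : Matrix (Fin 2) (Fin 2) (ZMod 2), A = X * Y * (X + Y) := by
  have neg_eq_self (M : Matrix (Fin 2) (Fin 2) (ZMod 2)) : -M = M := by
    ext i j
    exact ZMod.neg_eq_self_mod_two _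
  constructor
  · rintro ⟨X, Y, Z, hA, hsum⟩
    refine ⟨X, Y, ?_⟩
    rw [hA, eq_neg_of_add_eq_zero_right hsum, neg_eq_self]
  · rintro ⟨X, Y, hA⟩
    refine ⟨X, Y, X + Y, hA, ?_⟩
    exact add_eq_zero_iff_eq_neg.mpr (neg_eq_self _).symm

/-- Over `𝔽₂`, a `2 × 2` matrix admits a balanced decomposition into a
product of three factors iff it is neither `!![1,1;1,0]` nor `!![0,1;1,1]`. -/
theorem balanced_three_factors_two_by_two_F2 (A : Matrix (Fin 2) (Fin 2) (ZMod 2)) :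
    (∃ X₁ X₂ X₃ : Matrix (Fin 2) (Fin 2) (ZMod 2),
        A = X₁ * X₂ * X₃ ∧ X₁ + X₂ + X₃ = 0) ↔
      (A ≠ !![1, 1; 1, 0] ∧ A ≠ !![0, 1; 1, 1]) := by
  have key := exists_entries_mul_mul_add_iff (A 0 0) (A 0 1) (A 1 0) (A 1 1)
  have ext_iff (M N : Matrix (Fin 2) (Fin 2) (ZMod 2)) :
      M = N ↔ M 0 0 = N 0 0 ∧ M 0 1 = N 0 1 ∧ M 1 0 = N 1 0 ∧ M 1 1 = N 1 1 := by
    simp [← Matrix.ext_iff, Fin.forall_fin_two, and_assoc]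
  rw [exists_balanced_three_factors_iff, ne_eq, ne_eq, ext_iff A, ext_iff A]
  refine Iff.trans ?_ key
  constructor
  · rintro ⟨X, Y, hA⟩
    refine ⟨X 0 0, X 0 1, X 1 0, X 1 1, Y 0 0, Y 0 1, Y 1 0, Y 1 1, ?_⟩
    simp [hA, Matrix.mul_apply, Fin.sum_univ_two]
  · rintro ⟨a, b, c, d, e, f, g, h, hA⟩
    refine ⟨!![a, b; c, d], !![e, f; g, h], ?_⟩
    rw [ext_iff]
    simpa [Matrix.mul_apply, Fin.sum_univ_two] using hA
end

section
/- Over the two-element field F₂, a 2 × 2 matrix A admits a balanced decomposition into a product of four factors (i.e., there exist 2 × 2 matrices X₁, X₂, X₃, X₄ over F₂ with A = X₁·X₂·X₃·X₄ and X₁ + X₂ + X₃ + X₄ = 0) if and only if A is not similar (conjugate by an invertible 2 × 2 matrix over F₂) to the matrix with rows (1,0),(1,1). -/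
/-- No product `X * Y * Z * (X + Y + Z)` with nonsingular `X`, `Y`, `Z` over `𝔽₂` equals
`!![1, 0; 1, 1]`. -/
theorem mul_mul_mul_add_ne_transvection_of_nonsingular :
    ∀ X : Matrix (Fin 2) (Fin 2) (ZMod 2), X 0 0 * X 1 1 - X 0 1 * X 1 0 ≠ 0 →
    ∀ Y : Matrix (Fin 2) (Fin 2) (ZMod 2), Y 0 0 * Y 1 1 - Y 0 1 * Y 1 0 ≠ 0 →
    ∀ Z : Matrix (Fin 2) (Fin 2) (ZMod 2), Z 0 0 * Z 1 1 - Z 0 1 * Z 1 0 ≠ 0 →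
      X * Y * Z * (X + Y + Z) ≠ !![1, 0; 1, 1] := by
  decide +kernel

/-- No product `X * Y * Z * (X + Y + Z)` over `𝔽₂` equals `!![1, 0; 1, 1]`. -/
theorem mul_mul_mul_add_ne_transvection (X Y Z : Matrix (Fin 2) (Fin 2) (ZMod 2)) :
    X * Y * Z * (X + Y + Z) ≠ !![1, 0; 1, 1] := by
  intro h
  have hdet : (X * Y * Z * (X + Y + Z)).det ≠ 0 := by
    rw [h, Matrix.det_fin_two_of]
    decide
  simp only [Matrix.det_mul, mul_ne_zero_iff] at hdet
  obtain ⟨⟨⟨hX, hY⟩, hZ⟩, -⟩ := hdet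
  rw [Matrix.det_fin_two] at hX hY hZ
  exact mul_mul_mul_add_ne_transvection_of_nonsingular X hX Y hY Z hZ h

/-- Every `2 × 2` matrix over `𝔽₂` is a conjugate of `!![1, 0; 1, 1]` or a product of two
squares. -/
theorem conj_transvection_or_eq_mul_self_mul_mul_self :
    ∀ A : Matrix (Fin 2) (Fin 2) (ZMod 2),
      (∃ P : Matrix (Fin 2) (Fin 2) (ZMod 2),
        P 0 0 * P 1 1 - P 0 1 * P 1 0 ≠ 0 ∧ A * P = P * !![1, 0; 1, 1]) ∨
      ∃ X Y, A = X * X * Y * Y := by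
  decide +kernel

/-- Over `𝔽₂`, a `2 × 2` matrix admits a balanced decomposition into a
product of four factors iff it is not similar to `!![1,0;1,1]`. -/
theorem balanced_four_factors_two_by_two_F2 (A : Matrix (Fin 2) (Fin 2) (ZMod 2)) :
    (∃ X₁ X₂ X₃ X₄ : Matrix (Fin 2) (Fin 2) (ZMod 2),
        A = X₁ * X₂ * X₃ * X₄ ∧ X₁ + X₂ + X₃ + X₄ = 0) ↔
      ¬ ∃ P : (Matrix (Fin 2) (Fin 2) (ZMod 2))ˣ,
          A = (P : Matrix (Fin 2) (Fin 2) (ZMod 2)) * !![1, 0; 1, 1] *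
            ((P⁻¹ : (Matrix (Fin 2) (Fin 2) (ZMod 2))ˣ) :
              Matrix (Fin 2) (Fin 2) (ZMod 2)) := by
  constructor
  · rintro ⟨X, Y, Z, W, hprod, hsum⟩ ⟨P, hP⟩
    have hW : W = X + Y + Z :=
      (eq_neg_of_add_eq_zero_right hsum).trans (CharTwo.neg_eq _)
    apply mul_mul_mul_add_ne_transvection
      (P⁻¹.val * X * P.val) (P⁻¹.val * Y * P.val) (P⁻¹.val * Z * P.val)
    calc _ = P⁻¹.val * (X * Y * Z * (X + Y + Z)) * P.val := by
          simp only [← add_mul, ← mul_add, mul_assoc, Units.mul_inv_cancel_left]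
      _ = !![1, 0; 1, 1] := by
          rw [← hW, ← hprod, hP]
          simp only [mul_assoc, Units.inv_mul_cancel_left, Units.inv_mul, mul_one]
  · intro h
    obtain ⟨P, hdet, hA⟩ | ⟨X, Y, hA⟩ := conj_transvection_or_eq_mul_self_mul_mul_self A
    · rw [← Matrix.det_fin_two] at hdet
      obtain ⟨U, rfl⟩ := (Matrix.isUnit_iff_isUnit_det P).mpr hdet.isUnit
      exact absurd ⟨U, (Units.eq_mul_inv_iff_mul_eq U).mpr hA⟩ h
    · refine ⟨X, X, Y, Y, hA, ?_⟩
      rw [add_assoc, CharTwo.add_self_eq_zero, CharTwo.add_self_eq_zero, add_zero]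
end

section
/- Every 3 × 3 matrix A over the two-element field F₂ admits a balanced decomposition into a product of four factors: there exist 3 × 3 matrices X₁, X₂, X₃, X₄ over F₂ with A = X₁·X₂·X₃·X₄ and X₁ + X₂ + X₃ + X₄ = 0. -/
/-- A matrix admits a balanced decomposition into a product of four factors. -/
def IsBalancedFour {n R : Type*} [Fintype n] [Ring R] (A : Matrix n n R) : Prop :=
  ∃ X₁ X₂ X₃ X₄ : Matrix n n R, A = X₁ * X₂ * X₃ * X₄ ∧ X₁ + X₂ + X₃ + X₄ = 0

theorem IsBalancedFour.of_mul_eq_mul {n R : Type*} [Fintype n] [DecidableEq n] [CommRing R]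
    {A B P : Matrix n n R} (hP : IsUnit P.det) (hAB : A * P = P * B) (hB : IsBalancedFour B) :
    IsBalancedFour A := by
  obtain ⟨X₁, X₂, X₃, X₄, rfl, hsum⟩ := hB
  have cancel (M : Matrix n n R) : P⁻¹ * (P * M) = M := Matrix.nonsing_inv_mul_cancel_left P M hP
  refine ⟨P * X₁ * P⁻¹, P * X₂ * P⁻¹, P * X₃ * P⁻¹, P * X₄ * P⁻¹, ?_, ?_⟩
  · rw [← Matrix.mul_nonsing_inv_cancel_right P A hP, hAB]
    simp only [Matrix.mul_assoc, cancel]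
  · rw [← Matrix.add_mul, ← Matrix.add_mul, ← Matrix.add_mul, ← Matrix.mul_add, ← Matrix.mul_add,
      ← Matrix.mul_add, hsum, Matrix.mul_zero, Matrix.zero_mul]

theorem IsBalancedFour.of_isIdempotentElem {A : Matrix (Fin 3) (Fin 3) (ZMod 2)}
    (hA : A * A = A) : IsBalancedFour A :=
  ⟨A, A, A, A, by rw [hA, hA, hA], by rw [CharTwo.add_self_eq_zero, zero_add,
    CharTwo.add_self_eq_zero]⟩

theorem isBalancedFour_companion (a b c : ZMod 2) :
    IsBalancedFour !![0, 0, a; 1, 0, b; 0, 1, c] := by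
  obtain rfl | rfl : a = 0 ∨ a = 1 := by revert a; decide
  · refine ⟨!![0, 0, 0; 0, 0, 1; 1, 0, 0], !![0, 1, 0; 0, 0, 0; 0, 0, 1],
      !![0, 0, c; 1, 0, 0; 0, b, 1 + b],
      -(!![0, 0, 0; 0, 0, 1; 1, 0, 0] + !![0, 1, 0; 0, 0, 0; 0, 0, 1] +
        !![0, 0, c; 1, 0, 0; 0, b, 1 + b]), ?_, add_neg_cancel _⟩
    revert b c
    decide +kernel
  · refine ⟨!![1, 0, 0; 0, 0, 1; 0, 1, 0], !![0, 0, 1; 1, 0, 0; 0, 1, 0],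
      !![0, 1, b; 1, 1, 1 + b + c; 0, 0, 1],
      -(!![1, 0, 0; 0, 0, 1; 0, 1, 0] + !![0, 0, 1; 1, 0, 0; 0, 1, 0] +
        !![0, 1, b; 1, 1, 1 + b + c; 0, 0, 1]), ?_, add_neg_cancel _⟩
    revert b c
    decide +kernel

theorem isBalancedFour_scalar_add_nilpotent (t : ZMod 2) :
    IsBalancedFour !![t, 1, 0; 0, t, 0; 0, 0, t] := by
  obtain rfl | rfl : t = 0 ∨ t = 1 := by revert t; decide
  · exact ⟨!![1, 0, 0; 0, 0, 0; 0, 0, 0], !![1, 0, 0; 0, 0, 0; 0, 0, 0],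
      !![0, 1, 0; 0, 1, 0; 0, 0, 0], !![0, 1, 0; 0, 1, 0; 0, 0, 0],
      by decide +kernel, by decide +kernel⟩
  · exact ⟨!![0, 0, 1; 0, 1, 0; 1, 0, 0], !![0, 0, 1; 0, 1, 0; 1, 0, 0],
      !![1, 0, 1; 0, 1, 0; 0, 1, 1], !![1, 0, 1; 0, 1, 0; 0, 1, 1],
      by decide +kernel, by decide +kernel⟩

theorem mul_krylov_eq {R : Type*} [CommRing R] (A : Matrix (Fin 3) (Fin 3) R) (v : Fin 3 → R) :
    A * (Matrix.of ![v, A.mulVec v, A.mulVec (A.mulVec v)]).transpose =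
      (Matrix.of ![v, A.mulVec v, A.mulVec (A.mulVec v)]).transpose *
        !![0, 0, A.det;
          1, 0, A 0 1 * A 1 0 + A 0 2 * A 2 0 + A 1 2 * A 2 1 - A 0 0 * A 1 1 - A 0 0 * A 2 2 -
            A 1 1 * A 2 2;
          0, 1, A 0 0 + A 1 1 + A 2 2] := by
  ext i j
  fin_cases i <;> fin_cases j <;>
    simp [Matrix.mul_apply, Matrix.mulVec, dotProduct, Fin.sum_univ_three, Matrix.det_fin_three]
      <;> ring

/-- A `3 × 3` matrix over `𝔽₂` is idempotent, has a cyclic vector, or is similar to the sum of a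
scalar matrix and a square-zero matrix of rank one. -/
theorem idempotent_or_cyclic_or_scalar_add_nilpotent (A : Matrix (Fin 3) (Fin 3) (ZMod 2)) :
    A * A = A ∨ (∃ v, (Matrix.of ![v, A.mulVec v, A.mulVec (A.mulVec v)]).transpose.det = 1) ∨
    ∃ t v w, (Matrix.of ![A.mulVec v - t • v, v, w]).transpose.det = 1 ∧
      A * (Matrix.of ![A.mulVec v - t • v, v, w]).transpose =
        (Matrix.of ![A.mulVec v - t • v, v, w]).transpose * !![t, 1, 0; 0, t, 0; 0, 0, t] := by
  simp only [Matrix.det_fin_three]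
  rw [Matrix.eta_fin_three A]
  generalize A 0 0 = a, A 0 1 = b, A 0 2 = c, A 1 0 = d, A 1 1 = e, A 1 2 = f, A 2 0 = g,
    A 2 1 = h, A 2 2 = i
  revert a b c d e f g h i
  decide +kernel

/-- Every `3 × 3` matrix over `𝔽₂` admits a balanced decomposition into a
product of four factors. -/
theorem balanced_four_factors_three_by_three_F2 (A : Matrix (Fin 3) (Fin 3) (ZMod 2)) :
    ∃ X₁ X₂ X₃ X₄ : Matrix (Fin 3) (Fin 3) (ZMod 2),
      A = X₁ * X₂ * X₃ * X₄ ∧ X₁ + X₂ + X₃ + X₄ = 0 := by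
  change IsBalancedFour A
  obtain hA | ⟨v, hv⟩ | ⟨t, v, w, hdet, hA⟩ := idempotent_or_cyclic_or_scalar_add_nilpotent A
  · exact .of_isIdempotentElem hA
  · exact .of_mul_eq_mul (hv ▸ isUnit_one) (mul_krylov_eq A v) (isBalancedFour_companion _ _ _)
  · exact .of_mul_eq_mul (hdet ▸ isUnit_one) hA (isBalancedFour_scalar_add_nilpotent t)
end
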